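/- Theorem 3(a) (two-layer sampling): let B₁ : Matrix V E ℝ, let F₀ : Matrix V V ℝ and F₁ : Matrix E E ℝ, let D_A : Matrix V V ℝ and D_S : Matrix E E ℝ be diagonal matrices with diagonal entries in {0,1}, and suppose the ℓ²-operator norms of (1 − D_A) * F₀ and of (1 − D_S) * F₁ are both strictly less than 1. Let s⁰ ∈ ℝ^V with F₀.mulVec s⁰ = s⁰, let s̄¹ ∈ ℝ^E with F₁.mulVec s̄¹ = s̄¹, and let s¹ := s̄¹ + B₁ᵀ.mulVec s⁰. Then the matrices 1 − (1 − D_A) * F₀ and 1 − (1 − D_S) * F₁ are invertible and (s⁰, s̄¹) is perfectly recovered from the samples D_A.mulVec s⁰ and D_S.mulVec s¹ via: s⁰ = (1 − (1 − D_A) * F₀)⁻¹.mulVec (D_A.mulVec s⁰) and s̄¹ = (1 − (1 − D_S) * F₁)⁻¹.mulVec (D_S.mulVec s¹ − D_S.mulVec (B₁ᵀ.mulVec s⁰_rec)), where s⁰_rec := (1 − (1 − D_A) * F₀)⁻¹.mulVec (D_A.mulVec s⁰). -/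

import Mathlib

open Matrix

/-- The ℓ²-operator norm of a real square matrix, i.e. the operator norm of the induced
linear map on the corresponding Euclidean space. -/
noncomputable def l2OpNorm {ι : Type*} [Fintype ι] [DecidableEq ι] (M : Matrix ι ι ℝ) : ℝ :=
  ‖LinearMap.toContinuousLinearMap (Matrix.toEuclideanLin M)‖

open scoped Matrix.Norms.L2Operator in
/-- The Neumann series: `1 - M` is invertible when the ℓ²-operator norm of `M` is below `1`. -/
theorem isUnit_one_sub_of_l2OpNorm_lt_one {ι : Type*} [Fintype ι] [DecidableEq ι]
    {M : Matrix ι ι ℝ} (hM : l2OpNorm M < 1) : IsUnit (1 - M) := by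
  have : CompleteSpace (Matrix ι ι ℝ) := FiniteDimensional.complete ℝ _
  exact isUnit_one_sub_of_norm_lt_one (x := M) hM

/-- A bandlimited signal is recovered from its samples whenever `1 - (1 - D) * F` is invertible. -/
theorem inv_mulVec_sample_eq {ι : Type*} [Fintype ι] [DecidableEq ι]
    {D F : Matrix ι ι ℝ} (hU : IsUnit (1 - (1 - D) * F)) {x : ι → ℝ} (hx : F.mulVec x = x) :
    (1 - (1 - D) * F)⁻¹.mulVec (D.mulVec x) = x := by
  have h : D.mulVec x = (1 - (1 - D) * F).mulVec x := by
    rw [sub_mulVec, ← mulVec_mulVec, hx, sub_mulVec, one_mulVec, sub_sub_cancel]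
  rw [h, mulVec_mulVec, nonsing_inv_mul _ ((isUnit_iff_isUnit_det _).mp hU), one_mulVec]

/-- Theorem 3(a): two-layer sampling. The vertex signal `s⁰` and the solenoidal-plus-harmonic
part `s̄¹` of the edge signal `s¹ = s̄¹ + B₁ᵀ s⁰` are perfectly recovered from the samples
`D_A s⁰` and `D_S s¹`. -/
theorem two_layer_sampling {V E : Type*} [Fintype V] [Fintype E] [DecidableEq V] [DecidableEq E]
    (B₁ : Matrix V E ℝ) (F₀ : Matrix V V ℝ) (F₁ : Matrix E E ℝ)
    (DA : Matrix V V ℝ) (DS : Matrix E E ℝ)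
    (hDAdiag : ∀ i j, i ≠ j → DA i j = 0) (hDA01 : ∀ i, DA i i = 0 ∨ DA i i = 1)
    (hDSdiag : ∀ i j, i ≠ j → DS i j = 0) (hDS01 : ∀ i, DS i i = 0 ∨ DS i i = 1)
    (hA : l2OpNorm ((1 - DA) * F₀) < 1) (hS : l2OpNorm ((1 - DS) * F₁) < 1)
    (s0 : V → ℝ) (hs0 : F₀.mulVec s0 = s0)
    (sbar : E → ℝ) (hsbar : F₁.mulVec sbar = sbar) :
    IsUnit (1 - (1 - DA) * F₀) ∧ IsUnit (1 - (1 - DS) * F₁) ∧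
    (let s1 : E → ℝ := sbar + B₁ᵀ.mulVec s0
     let s0rec : V → ℝ := (1 - (1 - DA) * F₀)⁻¹.mulVec (DA.mulVec s0)
     s0 = s0rec ∧
     sbar = (1 - (1 - DS) * F₁)⁻¹.mulVec
        (DS.mulVec s1 - DS.mulVec (B₁ᵀ.mulVec s0rec))) := by
  have hUA := isUnit_one_sub_of_l2OpNorm_lt_one hA
  have hUS := isUnit_one_sub_of_l2OpNorm_lt_one hS
  refine ⟨hUA, hUS, (inv_mulVec_sample_eq hUA hs0).symm, ?_⟩
  rw [inv_mulVec_sample_eq hUA hs0, ← mulVec_sub, add_sub_cancel_right,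
    inv_mulVec_sample_eq hUS hsbar]
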